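/- arXiv:1909.08121 — 2 statements merged into one kernel-verified Lean document; each statement's English description precedes it below -/
import Mathlib

section
/- Let λ ∈ (0, 1) and set δ(λ) := max{4λ−1, 2λ}. Then there exist a constant C > 0 and N ∈ ℕ such that for all n ≥ N, |‖C_n^{(λ+1)}‖₂² − n^{4λ}/(4λ·Γ(2λ+1)²)| ≤ C·n^{δ(λ)}. -/
open Real MeasureTheory Finset

/-- Gegenbauer polynomials `C_n^{(λ)}`: `C_0 = 1`, `C_1 = 2λx`, and
`n C_n(x) = 2(n+λ-1) x C_{n-1}(x) - (n+2λ-2) C_{n-2}(x)` for `n ≥ 2`. -/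
noncomputable def gegenbauer (lam : ℝ) : ℕ → ℝ → ℝ
  | 0, _ => 1
  | 1, x => 2 * lam * x
  | n + 2, x =>
      (2 * ((n : ℝ) + 1 + lam) * x * gegenbauer lam (n + 1) x
        - ((n : ℝ) + 2 * lam) * gegenbauer lam n x) / ((n : ℝ) + 2)

lemma geg_zero (a x : ℝ) : gegenbauer a 0 x = 1 := by simp [gegenbauer]
lemma geg_one (a x : ℝ) : gegenbauer a 1 x = 2 * a * x := by simp [gegenbauer]
lemma geg_def (a : ℝ) (n : ℕ) (x : ℝ) : gegenbauer a (n+2) x =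
    (2 * ((n : ℝ) + 1 + a) * x * gegenbauer a (n + 1) x
        - ((n : ℝ) + 2 * a) * gegenbauer a n x) / ((n : ℝ) + 2) := by
  rw [gegenbauer]
lemma geg_rec (a : ℝ) (n : ℕ) (x : ℝ) : ((n:ℝ)+2) * gegenbauer a (n+2) x =
    2 * ((n : ℝ) + 1 + a) * x * gegenbauer a (n + 1) x
        - ((n : ℝ) + 2 * a) * gegenbauer a n x := by
  rw [geg_def]; field_simp

lemma geg_AB (a x : ℝ) (n : ℕ) :
    (((n:ℝ)+1+2*a) * gegenbauer a (n+1) x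
      = 2*a*(gegenbauer (a+1) (n+1) x - x * gegenbauer (a+1) n x)) ∧
    (((n:ℝ)+2) * gegenbauer a (n+2) x
      = 2*a*(x * gegenbauer (a+1) (n+1) x - gegenbauer (a+1) n x)) ∧
    (((n:ℝ)+2+2*a) * gegenbauer a (n+2) x
      = 2*a*(gegenbauer (a+1) (n+2) x - x * gegenbauer (a+1) (n+1) x)) := by
  have key : ∀ n : ℕ, (((n:ℝ)+2) * gegenbauer a (n+2) x
      = 2*a*(x * gegenbauer (a+1) (n+1) x - gegenbauer (a+1) n x)) →
    (((n:ℝ)+2+2*a) * gegenbauer a (n+2) x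
      = 2*a*(gegenbauer (a+1) (n+2) x - x * gegenbauer (a+1) (n+1) x)) := by
    intro n h
    have h2 : ((n:ℝ)+2) ≠ 0 := by positivity
    apply mul_left_cancel₀ h2
    have h3 := geg_rec (a+1) n x
    linear_combination ((n:ℝ)+2+2*a) * h - 2*a*h3
  induction n with
  | zero =>
    have h1 : ((0:ℕ):ℝ)+2 ≠ 0 := by norm_num
    have hA : (((0:ℕ):ℝ)+2) * gegenbauer a (0+2) x
      = 2*a*(x * gegenbauer (a+1) (0+1) x - gegenbauer (a+1) 0 x) := by
      rw [geg_rec]; simp only [zero_add, geg_one, geg_zero, Nat.cast_zero]; ring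
    refine ⟨?_, hA, key 0 hA⟩
    simp only [zero_add, geg_one, geg_zero, Nat.cast_zero]; ring
  | succ n ih =>
    obtain ⟨h1, h2, h3⟩ := ih
    have hA : (((n+1:ℕ):ℝ)+2) * gegenbauer a (n+1+2) x
      = 2*a*(x * gegenbauer (a+1) (n+1+1) x - gegenbauer (a+1) (n+1) x) := by
      rw [geg_rec]; push_cast
      linear_combination x * h2 + x * h3 - h1
    refine ⟨?_, hA, key (n+1) hA⟩
    push_cast
    linear_combination h3

lemma geg_deriv (a x : ℝ) (n : ℕ) :
    HasDerivAt (gegenbauer a (n+1)) (2*a*gegenbauer (a+1) n x) x := by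
  have h0 : HasDerivAt (gegenbauer a 0) 0 x := by
    have : gegenbauer a 0 = fun _ => (1:ℝ) := by funext y; exact geg_zero a y
    rw [this]; exact hasDerivAt_const _ _
  have h1 : HasDerivAt (gegenbauer a 1) (2*a) x := by
    have : gegenbauer a 1 = fun y => 2 * a * y := by funext y; exact geg_one a y
    rw [this]; simpa using (hasDerivAt_id x).const_mul (2*a)
  have step : ∀ (n : ℕ) (p q : ℝ), HasDerivAt (gegenbauer a n) p x →
      HasDerivAt (gegenbauer a (n+1)) q x →
      HasDerivAt (gegenbauer a (n+2)) ((2 * ((n : ℝ) + 1 + a) * (gegenbauer a (n + 1) x + x * q)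
        - ((n : ℝ) + 2 * a) * p) / ((n : ℝ) + 2)) x := by
    intro n p q hp hq
    have : gegenbauer a (n+2) = fun y => (2 * ((n : ℝ) + 1 + a) * (y * gegenbauer a (n + 1) y)
        - ((n : ℝ) + 2 * a) * gegenbauer a n y) / ((n : ℝ) + 2) := by
      funext y; rw [geg_def]; ring
    rw [this]
    have := ((((hasDerivAt_id x).mul hq).const_mul (2 * ((n : ℝ) + 1 + a))).sub
      (hp.const_mul ((n : ℝ) + 2 * a))).div_const ((n : ℝ) + 2)
    simpa using this
  have main : ∀ n : ℕ, HasDerivAt (gegenbauer a (n+1)) (2*a*gegenbauer (a+1) n x) x ∧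
      HasDerivAt (gegenbauer a (n+2)) (2*a*gegenbauer (a+1) (n+1) x) x := by
    intro n
    induction n with
    | zero =>
      constructor
      · simpa [geg_zero] using h1
      · convert step 0 _ _ h0 h1 using 1
        simp [geg_one]; ring
    | succ n ih =>
      refine ⟨ih.2, ?_⟩
      convert step (n+1) _ _ ih.1 ih.2 using 1
      obtain ⟨g1, g2, g3⟩ := geg_AB a x n
      have r := geg_rec (a+1) n x
      have hn : ((n:ℝ)+1+2) ≠ 0 := by positivity
      push_cast
      rw [eq_div_iff hn]
      show 2 * a * gegenbauer (a+1) (n+2) x * _ = 2 * (_) * (gegenbauer a (n+2) x + _) - _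
      linear_combination 2 * a * r - g2 - g3
  exact (main n).1

lemma geg_ode (a : ℝ) (ha : 0 < a) (x : ℝ) (n : ℕ) : ∃ q' : ℝ,
    HasDerivAt (gegenbauer (a+1) n) q' x ∧
    (1 - x^2) * q' = (2*a+1)*x*gegenbauer (a+1) n x
      - ((n:ℝ)+1)*((n:ℝ)+1+2*a) * gegenbauer a (n+1) x / (2*a) := by
  have hB := (geg_AB a x n).1
  have : ((n:ℝ)+1)*((n:ℝ)+1+2*a) * gegenbauer a (n+1) x / (2*a) =
    ((n:ℝ)+1) * (gegenbauer (a+1) (n+1) x - x * gegenbauer (a+1) n x) := by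
    rw [div_eq_iff (by positivity)]; linear_combination ((n:ℝ)+1)*hB
  rw [this]
  cases n with
  | zero =>
    refine ⟨0, ?_, ?_⟩
    · have : gegenbauer (a+1) 0 = fun _ => (1:ℝ) := by funext y; exact geg_zero _ y
      rw [this]; exact hasDerivAt_const _ _
    · simp [geg_zero, geg_one]; ring
  | succ n =>
    refine ⟨_, geg_deriv (a+1) x n, ?_⟩
    obtain ⟨g1, g2, g3⟩ := geg_AB (a+1) x n
    push_cast
    show _ = _ - _ * (gegenbauer (a+1) (n+2) x - _)
    linear_combination -x*g1 + g2

lemma geg_cont (a : ℝ) (n : ℕ) : Continuous (gegenbauer a n) := by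
  cases n with
  | zero =>
    have : gegenbauer a 0 = fun _ => (1:ℝ) := by funext y; exact geg_zero a y
    rw [this]; exact continuous_const
  | succ n => exact continuous_iff_continuousAt.2 fun x => (geg_deriv a x n).continuousAt

/-- First integral identity. -/
lemma geg_int1 (a : ℝ) (ha : 0 < a) (n : ℕ) :
    4*a * ∫ x in (0:ℝ)..1, x * (gegenbauer (a+1) n x)^2 =
      ((n:ℝ)+1)*((n:ℝ)+1+2*a) * (gegenbauer a (n+1) 1)^2 / (4*a^2)
      - (gegenbauer (a+1) n 0)^2
      - ((n:ℝ)+1)*((n:ℝ)+1+2*a) * (gegenbauer a (n+1) 0)^2 / (4*a^2) := by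
  have hd : ∀ x ∈ Set.uIcc (0:ℝ) 1, HasDerivAt (fun x => (1 - x^2) * (gegenbauer (a+1) n x)^2
      + ((n:ℝ)+1)*((n:ℝ)+1+2*a) / (4*a^2) * (gegenbauer a (n+1) x)^2)
      (4*a*(x * (gegenbauer (a+1) n x)^2)) x := by
    intro x _
    obtain ⟨q', hq, he⟩ := geg_ode a ha x n
    have hu := geg_deriv a x n
    have := ((((hasDerivAt_id x).pow 2).const_sub 1).mul (hq.pow 2)).add
      ((hu.pow 2).const_mul (((n:ℝ)+1)*((n:ℝ)+1+2*a) / (4*a^2)))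
    refine this.congr_deriv ?_
    simp only [id, Pi.mul_apply, Pi.pow_apply, Pi.add_apply, Pi.sub_apply, Nat.cast_ofNat]
    field_simp at he ⊢
    linear_combination (4*gegenbauer (a+1) n x) * he
  have hc := geg_cont (a+1) n
  have := intervalIntegral.integral_eq_sub_of_hasDerivAt hd
    (Continuous.intervalIntegrable (by fun_prop) _ _)
  rw [intervalIntegral.integral_const_mul] at this
  rw [this]; ring

/-- Second integral identity. -/
lemma geg_int2 (a : ℝ) (ha : 0 < a) (n : ℕ) :
    2*a * ∫ x in (0:ℝ)..1, (1 - x^2) * (gegenbauer (a+1) n x)^2 =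
      (((n:ℝ)+1)*((n:ℝ)+1+2*a) / (2*a) + (2*a-1)/(4*a)) *
        (∫ x in (0:ℝ)..1, (gegenbauer a (n+1) x)^2)
      - (2*a-1)/(4*a) * (gegenbauer a (n+1) 1)^2
      - gegenbauer a (n+1) 0 * gegenbauer (a+1) n 0 := by
  have hd : ∀ x ∈ Set.uIcc (0:ℝ) 1, HasDerivAt
      (fun x => (1 - x^2) * (gegenbauer a (n+1) x * gegenbauer (a+1) n x)
      - (2*a-1)/(4*a) * (x * (gegenbauer a (n+1) x)^2))
      (2*a*((1-x^2) * (gegenbauer (a+1) n x)^2) -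
        (((n:ℝ)+1)*((n:ℝ)+1+2*a) / (2*a) + (2*a-1)/(4*a)) * (gegenbauer a (n+1) x)^2) x := by
    intro x _
    obtain ⟨q', hq, he⟩ := geg_ode a ha x n
    have hu := geg_deriv a x n
    have := ((((hasDerivAt_id x).pow 2).const_sub 1).mul (hu.mul hq)).sub
      (((hasDerivAt_id x).mul (hu.pow 2)).const_mul ((2*a-1)/(4*a)))
    refine this.congr_deriv ?_
    simp only [id, Pi.mul_apply, Pi.pow_apply, Pi.add_apply, Pi.sub_apply, Nat.cast_ofNat]
    field_simp at he ⊢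
    linear_combination (4*gegenbauer a (n+1) x) * he
  have hc := geg_cont (a+1) n
  have hc' := geg_cont a (n+1)
  have := intervalIntegral.integral_eq_sub_of_hasDerivAt hd
    (Continuous.intervalIntegrable (by fun_prop) _ _)
  rw [intervalIntegral.integral_sub (Continuous.intervalIntegrable (by fun_prop) _ _)
    (Continuous.intervalIntegrable (by fun_prop) _ _),
    intervalIntegral.integral_const_mul, intervalIntegral.integral_const_mul] at this
  simp only [one_pow, sub_self, zero_mul, one_mul] at this
  linear_combination this

lemma sonin_alg (a x u q M q' r : ℝ) (hd : (M+a^2)*(1-x^2) + a*(1-a) ≠ 0)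
    (he2 : 2*a*((1-x^2)*q') = 2*a*(2*a+1)*x*q - M * u) :
    -(2 * x) * a * r * (u^2 + (a*(x*u) - 2*a*((1-x^2)*q))^2 / ((M+a^2)*(1-x^2) + a*(1-a))) +
     r*(1-x^2) * (2*u*(2*a*q) + (2 * (a*(x*u) - 2*a*((1-x^2)*q)) *
       (a * (u + x * (2*a*q)) - 2*a*(-(2*x)*q + (1-x^2)*q')) * ((M+a^2)*(1-x^2) + a*(1-a)) -
       (a*(x*u) - 2*a*((1-x^2)*q))^2 * ((M+a^2) * -(2*x))) / ((M+a^2)*(1-x^2) + a*(1-a))^2)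
     = -(r * (2*(a*(1-a))*x*(a*(x*u) - 2*a*((1-x^2)*q))^2
      / ((M+a^2)*(1-x^2) + a*(1-a))^2)) := by
  have e : 2*a*(-(2*x)*q + (1-x^2)*q') = 2*a*(2*a-1)*x*q - M*u := by linear_combination he2
  rw [e]
  generalize hdd : (M+a^2)*(1-x^2) + a*(1-a) = d at *
  field_simp
  subst hdd
  ring

/-- Sonin-type bound. -/
lemma geg_sonin (a : ℝ) (ha : 0 < a) (ha1 : a < 1) (n : ℕ) (x : ℝ) (hx : x ∈ Set.Ico (0:ℝ) 1) :
    (1 - x^2)^a * (gegenbauer a (n+1) x)^2 ≤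
      (gegenbauer a (n+1) 0)^2 + 4*a^2*(gegenbauer (a+1) n 0)^2 /
        (((n:ℝ)+1)*((n:ℝ)+1+2*a)) := by
  set M : ℝ := ((n:ℝ)+1)*((n:ℝ)+1+2*a) with hM
  have hM0 : 0 < M := by positivity
  have hb : 0 < a*(1-a) := mul_pos ha (by linarith)
  set F : ℝ → ℝ := fun x => (1 - x^2)^a * ((gegenbauer a (n+1) x)^2 +
    (a*(x*gegenbauer a (n+1) x) - 2*a*((1-x^2)*gegenbauer (a+1) n x))^2 /
      ((M+a^2)*(1-x^2) + a*(1-a))) with hF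
  have hpos : ∀ x ∈ Set.Ico (0:ℝ) 1, 0 < 1 - x^2 := by
    rintro y ⟨h0, h1⟩; nlinarith
  have hder : ∀ x ∈ Set.Ico (0:ℝ) 1, ∃ F', HasDerivAt F F' x ∧ F' ≤ 0 := by
    intro x hx
    have hs := hpos x hx
    obtain ⟨q', hq, he⟩ := geg_ode a ha x n
    rw [← hM] at he
    have hu := geg_deriv a x n
    have hs' := ((hasDerivAt_id x).pow 2).const_sub 1
    have hsa := hs'.rpow_const (p := a) (Or.inl (by simpa using hs.ne'))
    have hdpos : 0 < (M+a^2)*(1-x^2) + a*(1-a) := by positivity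
    have hd' := (hs'.const_mul (M+a^2)).add_const (a*(1-a))
    have hw := (((hasDerivAt_id x).mul hu).const_mul a).sub ((hs'.mul hq).const_mul (2*a))
    have := hsa.mul ((hu.pow 2).add ((hw.pow 2).div hd' (by simpa using hdpos.ne')))
    refine ⟨_, this, ?_⟩
    simp only [id, Pi.mul_apply, Pi.pow_apply, Pi.add_apply, Pi.sub_apply, Pi.div_apply]
    have hra : (1 - x^2)^a = (1-x^2)^(a-1) * (1-x^2) := by
      rw [← rpow_add_one hs.ne']; congr 1; ring
    have he2 : 2*a*((1-x^2)*q') = 2*a*(2*a+1)*x*gegenbauer (a+1) n x - M * gegenbauer a (n+1) x := by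
      rw [he]; field_simp
    rw [hra]
    have alg := sonin_alg a x (gegenbauer a (n+1) x) (gegenbauer (a+1) n x) M q'
      ((1-x^2)^(a-1)) hdpos.ne' he2
    norm_num only [Nat.cast_ofNat, pow_one, mul_one, one_mul]
    rw [alg]
    have : 0 ≤ (1 - x^2)^(a-1) := rpow_nonneg hs.le _
    have hx0 := hx.1
    have : 0 ≤ (1 - x^2)^(a-1) * (2*(a*(1-a))*x*(a*(x*gegenbauer a (n+1) x) - 2*a*((1-x^2)*gegenbauer (a+1) n x))^2
      / ((M+a^2)*(1-x^2) + a*(1-a))^2) := by positivity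
    linarith
  have hanti : AntitoneOn F (Set.Icc 0 x) := by
    apply antitoneOn_of_deriv_nonpos (convex_Icc 0 x)
    · intro y hy
      obtain ⟨F', h, _⟩ := hder y ⟨hy.1, hy.2.trans_lt hx.2⟩
      exact h.continuousAt.continuousWithinAt
    · intro y hy
      rw [interior_Icc] at hy
      obtain ⟨F', h, _⟩ := hder y ⟨hy.1.le, hy.2.trans hx.2⟩
      exact h.differentiableAt.differentiableWithinAt
    · intro y hy
      rw [interior_Icc] at hy
      obtain ⟨F', h, h'⟩ := hder y ⟨hy.1.le, hy.2.trans hx.2⟩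
      rw [h.deriv]; exact h'
  have h1 : F x ≤ F 0 := hanti ⟨le_rfl, hx.1⟩ ⟨hx.1, le_rfl⟩ hx.1
  have hs := hpos x hx
  have h2 : (1 - x^2)^a * (gegenbauer a (n+1) x)^2 ≤ F x := by
    have hdpos : 0 < (M+a^2)*(1-x^2) + a*(1-a) := by positivity
    simp only [hF]
    apply mul_le_mul_of_nonneg_left _ (rpow_nonneg hs.le a)
    have : 0 ≤ (a*(x*gegenbauer a (n+1) x) - 2*a*((1-x^2)*gegenbauer (a+1) n x))^2 /
      ((M+a^2)*(1-x^2) + a*(1-a)) := by positivity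
    linarith
  have h3 : F 0 ≤ (gegenbauer a (n+1) 0)^2 + 4*a^2*(gegenbauer (a+1) n 0)^2 / M := by
    simp only [hF]
    have : (1 - (0:ℝ)^2) = 1 := by norm_num
    rw [this, one_rpow, one_mul]
    have e : (a*(0*gegenbauer a (n+1) 0) - 2*a*(1*gegenbauer (a+1) n 0))^2
      = 4*a^2*(gegenbauer (a+1) n 0)^2 := by ring
    rw [e]
    gcongr
    nlinarith
  linarith

lemma geg_L2 (a : ℝ) (ha : 0 < a) (ha1 : a < 1) (n : ℕ) :
    ((n:ℝ)+1)*((n:ℝ)+1+2*a) * (∫ x in (0:ℝ)..1, (gegenbauer a (n+1) x)^2) ≤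
      (((n:ℝ)+1)*((n:ℝ)+1+2*a) * (gegenbauer a (n+1) 0)^2
        + 4*a^2*(gegenbauer (a+1) n 0)^2) / (1-a) := by
  have hson := geg_sonin a ha ha1 n
  set M : ℝ := ((n:ℝ)+1)*((n:ℝ)+1+2*a) with hM
  have hM0 : 0 < M := by positivity
  set K : ℝ := (gegenbauer a (n+1) 0)^2 + 4*a^2*(gegenbauer (a+1) n 0)^2 / M with hK
  have hint : IntervalIntegrable (fun x : ℝ => (1-x)^(-a)) volume 0 1 := by
    have := (intervalIntegral.intervalIntegrable_rpow' (a := 0) (b := 1) (r := -a)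
      (by linarith)).comp_sub_left 1
    simpa using this.symm
  have hval : ∫ x in (0:ℝ)..1, (1-x)^(-a) = 1/(1-a) := by
    rw [intervalIntegral.integral_comp_sub_left (fun x : ℝ => x^(-a)) 1]
    simp only [sub_self, sub_zero]
    rw [integral_rpow (Or.inl (by linarith)), one_rpow, zero_rpow (by linarith)]
    rw [sub_zero]; congr 1; ring
  have hc' := geg_cont a (n+1)
  have hle : ∫ x in (0:ℝ)..1, (gegenbauer a (n+1) x)^2 ≤ ∫ x in (0:ℝ)..1, K * (1-x)^(-a) := by
    apply intervalIntegral.integral_mono_on_of_le_Ioo zero_le_one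
      (Continuous.intervalIntegrable (by fun_prop) _ _) (hint.const_mul K)
    intro x hx
    have h1 := hson x ⟨hx.1.le, hx.2⟩
    have hp : 0 < 1 - x := by linarith [hx.2]
    have h2 : (1-x)^a ≤ (1-x^2)^a := by
      apply rpow_le_rpow hp.le _ ha.le
      nlinarith [hx.1, hx.2]
    have h3 : (1-x)^a * (gegenbauer a (n+1) x)^2 ≤ K :=
      (mul_le_mul_of_nonneg_right h2 (sq_nonneg _)).trans h1
    rw [rpow_neg hp.le, ← div_eq_mul_inv, le_div_iff₀ (rpow_pos_of_pos hp a), mul_comm]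
    exact h3
  rw [intervalIntegral.integral_const_mul, hval] at hle
  calc M * _ ≤ M * (K * (1/(1-a))) := mul_le_mul_of_nonneg_left hle hM0.le
    _ = _ := by rw [hK]; field_simp

lemma gam_bd (a : ℝ) (ha : 0 < a) (ha1 : a ≤ 1) (n : ℕ) :
    Gamma ((n:ℝ)+1) * (n:ℝ)^a ≤ Gamma ((n:ℝ)+1+a) ∧
    Gamma ((n:ℝ)+1+a) ≤ Gamma ((n:ℝ)+1) * ((n:ℝ)+1)^a := by
  have hn : (0:ℝ) ≤ n := Nat.cast_nonneg n
  have hg1 : 0 < Gamma ((n:ℝ)+1) := Gamma_pos_of_pos (by positivity)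
  have hg2 : 0 < Gamma ((n:ℝ)+a) := Gamma_pos_of_pos (by positivity)
  have hg3 : 0 < Gamma ((n:ℝ)+1+a) := Gamma_pos_of_pos (by positivity)
  rcases eq_or_lt_of_le ha1 with h | h
  · subst h
    rw [rpow_one, rpow_one, Gamma_add_one (s := (n:ℝ)+1) (by positivity)]
    constructor <;> nlinarith
  constructor
  · have := Gamma_mul_add_mul_le_rpow_Gamma_mul_rpow_Gamma (s := (n:ℝ)+a) (t := (n:ℝ)+1+a)
      (a := a) (b := 1-a) (by positivity) (by positivity) ha (by linarith) (by ring)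
    have e1 : a * ((n:ℝ)+a) + (1-a)*((n:ℝ)+1+a) = (n:ℝ)+1 := by ring
    rw [e1] at this
    have e2 : Gamma ((n:ℝ)+1+a) = ((n:ℝ)+a) * Gamma ((n:ℝ)+a) := by
      rw [← Gamma_add_one (by positivity)]; congr 1; ring
    calc Gamma ((n:ℝ)+1) * (n:ℝ)^a ≤ Gamma ((n:ℝ)+1) * ((n:ℝ)+a)^a := by
          gcongr; linarith
      _ ≤ (Gamma ((n:ℝ)+a)^a * Gamma ((n:ℝ)+1+a)^(1-a)) * ((n:ℝ)+a)^a := by gcongr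
      _ = (((n:ℝ)+a) * Gamma ((n:ℝ)+a))^a * Gamma ((n:ℝ)+1+a)^(1-a) := by
          rw [mul_rpow (by positivity) hg2.le]; ring
      _ = Gamma ((n:ℝ)+1+a) := by
          rw [← e2, ← rpow_add hg3]; simp
  · have := Gamma_mul_add_mul_le_rpow_Gamma_mul_rpow_Gamma (s := (n:ℝ)+1) (t := (n:ℝ)+1+1)
      (a := 1-a) (b := a) (by positivity) (by positivity) (by linarith) ha (by ring)
    have e1 : (1-a) * ((n:ℝ)+1) + a*((n:ℝ)+1+1) = (n:ℝ)+1+a := by ring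
    rw [e1, Gamma_add_one (s := (n:ℝ)+1) (by positivity), mul_rpow (by positivity) hg1.le] at this
    calc _ ≤ _ := this
      _ = (Gamma ((n:ℝ)+1)^(1-a) * Gamma ((n:ℝ)+1)^a) * ((n:ℝ)+1)^a := by ring
      _ = _ := by rw [← rpow_add hg1]; simp

lemma gam_bd2 (a : ℝ) (ha : 0 < a) (ha1 : a ≤ 2) (n : ℕ) (hn1 : 1 ≤ n) :
    Gamma ((n:ℝ)+1) * (n:ℝ)^a ≤ Gamma ((n:ℝ)+1+a) ∧
    Gamma ((n:ℝ)+1+a) ≤ Gamma ((n:ℝ)+1) * ((n:ℝ)+2)^a := by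
  have hn : (0:ℝ) < n := by exact_mod_cast hn1
  have hg1 : 0 < Gamma ((n:ℝ)+1) := Gamma_pos_of_pos (by positivity)
  rcases le_or_gt a 1 with h | h
  · obtain ⟨h1, h2⟩ := gam_bd a ha h n
    refine ⟨h1, h2.trans ?_⟩
    gcongr; linarith
  · obtain ⟨h1, h2⟩ := gam_bd (a-1) (by linarith) (by linarith) n
    have e2 : Gamma ((n:ℝ)+1+a) = ((n:ℝ)+a) * Gamma ((n:ℝ)+1+(a-1)) := by
      have := Gamma_add_one (s := (n:ℝ)+a) (by positivity)
      rw [show (n:ℝ)+1+(a-1) = n + a by ring, ← this]; congr 1; ring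
    rw [e2]
    constructor
    · calc Gamma ((n:ℝ)+1) * (n:ℝ)^a = n * (Gamma ((n:ℝ)+1) * (n:ℝ)^(a-1)) := by
            rw [rpow_sub_one hn.ne']; field_simp
        _ ≤ _ := by gcongr; linarith
    · calc ((n:ℝ)+a) * Gamma ((n:ℝ)+1+(a-1))
          ≤ ((n:ℝ)+2) * (Gamma ((n:ℝ)+1) * ((n:ℝ)+2)^(a-1)) := by
            gcongr
            refine h2.trans ?_
            gcongr
            linarith
        _ = _ := by rw [rpow_sub_one (by positivity)]; field_simp

lemma geg_at_one (a : ℝ) (ha : 0 < a) (n : ℕ) :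
    ((n:ℝ)+1) * gegenbauer a (n+1) 1 * (Gamma (2*a) * Gamma ((n:ℝ)+1)) = Gamma ((n:ℝ)+1+2*a) := by
  induction n with
  | zero =>
    have := Gamma_add_one (s := 2*a) (by positivity)
    simp [geg_one]
    rw [add_comm, this]
  | succ n ih =>
    obtain ⟨h1, h2, -⟩ := geg_AB a 1 n
    have e1 := Gamma_add_one (s := (n:ℝ)+1+2*a) (by positivity)
    have e2 := Gamma_add_one (s := (n:ℝ)+1) (by positivity)
    push_cast
    rw [show (n:ℝ)+1+1+2*a = n+1+2*a+1 by ring, e1, e2, ← ih]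
    show _ * gegenbauer a (n+2) 1 * _ = _
    linear_combination (Gamma (2*a) * (((n:ℝ)+1)*Gamma ((n:ℝ)+1))) * (h2 - h1)

lemma geg_at_zero (a : ℝ) (ha : 0 < a) (ha1 : a < 1) (n : ℕ) :
    |gegenbauer (a+1) n 0| ≤ ((n:ℝ)+1)^a / Gamma (a+1) := by
  have hG : 0 < Gamma (a+1) := Gamma_pos_of_pos (by positivity)
  have main : ∀ k : ℕ, |gegenbauer (a+1) (2*k) 0| * (Gamma (a+1) * Gamma ((k:ℝ)+1))
      = Gamma ((k:ℝ)+1+a) ∧ gegenbauer (a+1) (2*k+1) 0 = 0 := by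
    intro k
    induction k with
    | zero => simp [geg_zero, geg_one, add_comm]
    | succ k ih =>
      obtain ⟨h1, h2⟩ := ih
      have r1 := geg_rec (a+1) (2*k) 0
      have r2 := geg_rec (a+1) (2*k+1) 0
      constructor
      · have r3 : gegenbauer (a+1) (2*k+2) 0 = -(((k:ℝ)+1+a)/(k+1) * gegenbauer (a+1) (2*k) 0) := by
          push_cast at r1
          field_simp
          linear_combination r1/2
        have e1 := Gamma_add_one (s := (k:ℝ)+1+a) (by positivity)
        have e2 := Gamma_add_one (s := (k:ℝ)+1) (by positivity)
        show |gegenbauer (a+1) (2*k+2) 0| * _ = _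
        push_cast
        rw [show (k:ℝ)+1+1+a = k+1+a+1 by ring, e1, e2, r3, abs_neg, abs_mul,
          abs_of_pos (by positivity), ← h1]
        field_simp
      · show gegenbauer (a+1) (2*k+3) 0 = 0
        rw [h2] at r2
        have : ((2*k+1:ℕ):ℝ) + 2 ≠ 0 := by positivity
        have r3 : (((2*k+1:ℕ):ℝ) + 2) * gegenbauer (a+1) (2*k+3) 0 = 0 := by
          rw [r2]; ring
        exact (mul_eq_zero.1 r3).resolve_left this
  rcases Nat.even_or_odd' n with ⟨k, h | h⟩
  · subst h
    have h1 := (main k).1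
    have hg1 : 0 < Gamma ((k:ℝ)+1) := Gamma_pos_of_pos (by positivity)
    have h2 := (gam_bd a ha ha1.le k).2
    rw [le_div_iff₀ hG]
    refine le_of_mul_le_mul_right ?_ hg1
    calc _ = Gamma ((k:ℝ)+1+a) := by rw [← h1]; ring
      _ ≤ _ := h2
      _ = ((k:ℝ)+1)^a * Gamma ((k:ℝ)+1) := by ring
      _ ≤ _ := by
        gcongr
        push_cast
        have : (0:ℝ) ≤ k := Nat.cast_nonneg k
        linarith
  · subst h
    rw [(main k).2, abs_zero]; positivity

lemma geg_A_bd (a : ℝ) (ha : 0 < a) (ha1 : a < 1) (n : ℕ) (hn1 : 1 ≤ n) :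
    (n:ℝ)^(4*a) ≤ ((n:ℝ)+1)*((n:ℝ)+1+2*a) * (gegenbauer a (n+1) 1)^2 * Gamma (2*a)^2 ∧
    ((n:ℝ)+1)*((n:ℝ)+1+2*a) * (gegenbauer a (n+1) 1)^2 * Gamma (2*a)^2
      ≤ (n:ℝ)^(4*a) + 242 * (n:ℝ)^(4*a-1) := by
  have hn : (1:ℝ) ≤ n := by exact_mod_cast hn1
  have hn0 : (0:ℝ) < n := by linarith
  have hg1 : 0 < Gamma ((n:ℝ)+1) := Gamma_pos_of_pos (by positivity)
  obtain ⟨h1, h2⟩ := gam_bd2 (2*a) (by positivity) (by linarith) n hn1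
  have h3 := geg_at_one a ha n
  rw [← h3] at h1 h2
  set R : ℝ := ((n:ℝ)+1) * gegenbauer a (n+1) 1 * Gamma (2*a) with hR
  have h1' : (n:ℝ)^(2*a) ≤ R := by
    refine le_of_mul_le_mul_right ?_ hg1
    calc _ = _ := mul_comm _ _
      _ ≤ _ := h1
      _ = _ := by rw [hR]; ring
  have h2' : R ≤ ((n:ℝ)+2)^(2*a) := by
    refine le_of_mul_le_mul_right ?_ hg1
    calc _ = _ := by rw [hR]; ring
      _ ≤ _ := h2
      _ = _ := mul_comm _ _
  have eA : ((n:ℝ)+1)*((n:ℝ)+1+2*a) * (gegenbauer a (n+1) 1)^2 * Gamma (2*a)^2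
      = ((n:ℝ)+1+2*a)/(n+1) * R^2 := by
    rw [hR]; field_simp
  rw [eA]
  have hp : (0:ℝ) ≤ (n:ℝ)^(2*a) := by positivity
  have hsq : ∀ y : ℝ, 0 ≤ y → (y^(2*a))^2 = y^(4*a) := by
    intro y hy
    rw [← rpow_natCast, ← rpow_mul hy]; congr 1; push_cast; ring
  have hR0 : 0 ≤ R := hp.trans h1'
  constructor
  · rw [← hsq n hn0.le]
    have : 1 ≤ ((n:ℝ)+1+2*a)/(n+1) := by rw [le_div_iff₀ (by positivity)]; linarith
    calc ((n:ℝ)^(2*a))^2 ≤ R^2 := by gcongr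
      _ ≤ _ := le_mul_of_one_le_left (sq_nonneg _) this
  · have b1 : ((n:ℝ)+1+2*a)/(n+1) ≤ 1 + 2/n := by
      rw [div_le_iff₀ (by positivity)]
      field_simp
      nlinarith
    have b2 : R^2 ≤ (n:ℝ)^(4*a) * (1+2/n)^(4:ℕ) := by
      calc R^2 ≤ (((n:ℝ)+2)^(2*a))^2 := by gcongr
        _ = ((n:ℝ)+2)^(4*a) := hsq _ (by positivity)
        _ = ((n:ℝ) * (1+2/n))^(4*a) := by congr 1; field_simp
        _ = (n:ℝ)^(4*a) * (1+2/n)^(4*a) := mul_rpow hn0.le (by positivity)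
        _ ≤ (n:ℝ)^(4*a) * (1+2/n)^(4:ℝ) := by
          gcongr
          · have : 0 ≤ 2/(n:ℝ) := by positivity
            linarith
          · linarith
        _ = _ := by norm_cast
    have b3 : (1+2/(n:ℝ))^5 ≤ 1 + 242 * (1/n) := by
      have t0 : 0 ≤ 1/(n:ℝ) := by positivity
      have t1 : 1/(n:ℝ) ≤ 1 := by rw [div_le_one hn0]; exact hn
      rw [show 2/(n:ℝ) = 2*(1/n) by ring]
      generalize 1/(n:ℝ) = t at t0 t1
      have p2 : t^2 ≤ t := by nlinarith
      have p3 : t^3 ≤ t := by nlinarith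
      have p4 : t^4 ≤ t := by nlinarith
      have p5 : t^5 ≤ t := by nlinarith
      nlinarith
    calc _ ≤ (1+2/(n:ℝ)) * ((n:ℝ)^(4*a) * (1+2/n)^(4:ℕ)) := by gcongr
      _ = (n:ℝ)^(4*a) * (1+2/n)^5 := by ring
      _ ≤ (n:ℝ)^(4*a) * (1 + 242 * (1/n)) := by gcongr
      _ = _ := by rw [rpow_sub_one hn0.ne']; ring

lemma geg_q0 (a : ℝ) (ha : 0 < a) (ha1 : a < 1) (n : ℕ) (hn1 : 1 ≤ n) :
    (gegenbauer (a+1) n 0)^2 ≤ 4 / Gamma (a+1)^2 * (n:ℝ)^(2*a) := by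
  have hn : (1:ℝ) ≤ n := by exact_mod_cast hn1
  have hG : 0 < Gamma (a+1) := Gamma_pos_of_pos (by positivity)
  have h := geg_at_zero a ha ha1 n
  have hsq : ∀ y : ℝ, 0 ≤ y → (y^a)^2 = y^(2*a) := by
    intro y hy
    rw [← rpow_natCast, ← rpow_mul hy]; congr 1; push_cast; ring
  calc (gegenbauer (a+1) n 0)^2 = |gegenbauer (a+1) n 0|^2 := (sq_abs _).symm
    _ ≤ (((n:ℝ)+1)^a / Gamma (a+1))^2 := by gcongr
    _ ≤ ((2 * (n:ℝ))^a / Gamma (a+1))^2 := by gcongr; linarith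
    _ = (2^a)^2 * (n:ℝ)^(2*a) / Gamma (a+1)^2 := by
      rw [div_pow, mul_rpow (by norm_num) (by linarith), mul_pow, hsq n (by linarith)]
    _ ≤ (2^(1:ℝ))^2 * (n:ℝ)^(2*a) / Gamma (a+1)^2 := by
      gcongr
      norm_num
    _ = _ := by rw [rpow_one]; ring

lemma geg_u0 (a : ℝ) (ha : 0 < a) (ha1 : a < 1) (n : ℕ) (hn1 : 1 ≤ n) :
    ((n:ℝ)+1)*((n:ℝ)+1+2*a) * (gegenbauer a (n+1) 0)^2 ≤ 12 / Gamma (a+1)^2 * (n:ℝ)^(2*a) := by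
  obtain ⟨k, rfl⟩ : ∃ k, n = k + 1 := ⟨n-1, by omega⟩
  have hG : 0 < Gamma (a+1) := Gamma_pos_of_pos (by positivity)
  have hA := (geg_AB a 0 k).2.1
  have h := geg_at_zero a ha ha1 k
  have hsq : ∀ y : ℝ, 0 ≤ y → (y^a)^2 = y^(2*a) := by
    intro y hy
    rw [← rpow_natCast, ← rpow_mul hy]; congr 1; push_cast; ring
  have hb : (gegenbauer (a+1) k 0)^2 ≤ ((k:ℝ)+1)^(2*a) / Gamma (a+1)^2 := by
    calc (gegenbauer (a+1) k 0)^2 = |gegenbauer (a+1) k 0|^2 := (sq_abs _).symm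
    _ ≤ (((k:ℝ)+1)^a / Gamma (a+1))^2 := by gcongr
    _ = _ := by rw [div_pow, hsq _ (by positivity)]
  have e : gegenbauer a (k+1+1) 0 = -(2*a*gegenbauer (a+1) k 0)/((k:ℝ)+2) := by
    rw [eq_div_iff (by positivity)]
    linear_combination hA
  push_cast
  rw [e]
  have c : ((k:ℝ)+1+1+2*a)/(k+2) * (4*a^2) ≤ 12 := by
    have : ((k:ℝ)+1+1+2*a)/(k+2) ≤ 3 := by
      rw [div_le_iff₀ (by positivity)]
      have : (0:ℝ) ≤ k := Nat.cast_nonneg k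
      linarith
    have h2 : 4*a^2 ≤ 4 := by nlinarith
    calc _ ≤ 3 * (4:ℝ) := by gcongr
      _ = 12 := by norm_num
  calc _ = ((k:ℝ)+1+1+2*a)/(k+2) * (4*a^2) * (gegenbauer (a+1) k 0)^2 := by
        field_simp; ring
    _ ≤ 12 * (((k:ℝ)+1)^(2*a) / Gamma (a+1)^2) := by gcongr
    _ = _ := by ring

set_option maxHeartbeats 2000000 in
theorem gegenbauer_L2_norm_asymptotic_small_lambda (lam : ℝ) (hlam : lam ∈ Set.Ioo (0 : ℝ) 1) :
    ∃ (C : ℝ) (N : ℕ), 0 < C ∧ ∀ n : ℕ, N ≤ n →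
      |(∫ x in (0:ℝ)..1, (gegenbauer (lam + 1) n x) ^ 2)
        - (n : ℝ) ^ (4 * lam) / (4 * lam * Real.Gamma (2 * lam + 1) ^ 2)|
      ≤ C * (n : ℝ) ^ (max (4 * lam - 1) (2 * lam)) := by
  obtain ⟨ha, ha1⟩ := hlam
  have hG : 0 < Gamma (lam+1) := Gamma_pos_of_pos (by positivity)
  have hG2 : 0 < Gamma (2*lam) := Gamma_pos_of_pos (by positivity)
  have h1a : 0 < 1 - lam := by linarith
  set K1 : ℝ := 243 / Gamma (2*lam)^2 with hK1
  set K2 : ℝ := 12 / Gamma (lam+1)^2 with hK2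
  have hK1p : 0 < K1 := by positivity
  have hK2p : 0 < K2 := by positivity
  -- bound constant for the integral of (1-x^2) q^2
  set K4 : ℝ := (5*K2/(1-lam)/lam + K1/(4*lam) + 2*K2)/(2*lam) with hK4
  have hK4p : 0 < K4 := by positivity
  refine ⟨K1/(16*lam^3) + K2/(4*lam) + K2/(16*lam^3) + K4, 1, by positivity, ?_⟩
  intro n hn1
  have hn : (1:ℝ) ≤ n := by exact_mod_cast hn1
  have hn0 : (0:ℝ) < n := by linarith
  set Z : ℝ := (n : ℝ) ^ (max (4 * lam - 1) (2 * lam)) with hZ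
  have z1 : (n:ℝ)^(4*lam-1) ≤ Z := rpow_le_rpow_of_exponent_le hn (le_max_left _ _)
  have z2 : (n:ℝ)^(2*lam) ≤ Z := rpow_le_rpow_of_exponent_le hn (le_max_right _ _)
  have hZ0 : 0 < Z := by positivity
  have i1 := geg_int1 lam ha n
  have i2 := geg_int2 lam ha n
  have l2 := geg_L2 lam ha ha1 n
  obtain ⟨A1, A2⟩ := geg_A_bd lam ha ha1 n hn1
  have q0 := geg_q0 lam ha ha1 n hn1
  have u0 := geg_u0 lam ha ha1 n hn1
  have hMn : (n:ℝ) ≤ ((n:ℝ)+1)*((n:ℝ)+1+2*lam) := by nlinarith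
  set M : ℝ := ((n:ℝ)+1)*((n:ℝ)+1+2*lam) with hM
  have hM1 : 1 ≤ M := hn.trans hMn
  have hc := geg_cont (lam+1) n
  have hI0 : 0 ≤ ∫ x in (0:ℝ)..1, (gegenbauer lam (n+1) x)^2 :=
    intervalIntegral.integral_nonneg zero_le_one fun x _ => sq_nonneg _
  -- splitting
  have hsplit : ∫ x in (0:ℝ)..1, (gegenbauer (lam + 1) n x) ^ 2 =
      (∫ x in (0:ℝ)..1, x * (gegenbauer (lam + 1) n x) ^ 2) +
      ∫ x in (0:ℝ)..1, (1 - x) * (gegenbauer (lam + 1) n x) ^ 2 := by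
    rw [← intervalIntegral.integral_add (Continuous.intervalIntegrable (by fun_prop) _ _)
      (Continuous.intervalIntegrable (by fun_prop) _ _)]
    congr 1; funext x; ring
  have hJ0 : 0 ≤ ∫ x in (0:ℝ)..1, (1 - x) * (gegenbauer (lam + 1) n x) ^ 2 :=
    intervalIntegral.integral_nonneg zero_le_one fun x hx =>
      mul_nonneg (by linarith [hx.2]) (sq_nonneg _)
  have hJ1 : ∫ x in (0:ℝ)..1, (1 - x) * (gegenbauer (lam + 1) n x) ^ 2 ≤
      ∫ x in (0:ℝ)..1, (1 - x^2) * (gegenbauer (lam + 1) n x) ^ 2 := by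
    apply intervalIntegral.integral_mono_on zero_le_one
      (Continuous.intervalIntegrable (by fun_prop) _ _)
      (Continuous.intervalIntegrable (by fun_prop) _ _)
    intro x hx
    apply mul_le_mul_of_nonneg_right _ (sq_nonneg _)
    nlinarith [hx.1, hx.2]
  have hGa : Gamma (2*lam+1) = 2*lam*Gamma (2*lam) := Gamma_add_one (by positivity)
  rw [hsplit, hGa]
  generalize (∫ x in (0:ℝ)..1, x * (gegenbauer (lam + 1) n x) ^ 2) = I at i1 ⊢
  generalize (∫ x in (0:ℝ)..1, (1 - x) * (gegenbauer (lam + 1) n x) ^ 2) = J at hJ0 hJ1 ⊢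
  generalize (∫ x in (0:ℝ)..1, (1 - x^2) * (gegenbauer (lam + 1) n x) ^ 2) = J2 at hJ1 i2
  generalize (∫ x in (0:ℝ)..1, (gegenbauer lam (n+1) x)^2) = U at hI0 i2 l2
  generalize gegenbauer lam (n+1) 0 = u at *
  generalize gegenbauer (lam+1) n 0 = q at *
  generalize gegenbauer lam (n+1) 1 = v at *
  have hq : q^2 ≤ K2 * Z := by
    calc q^2 ≤ _ := q0
      _ ≤ K2 * Z := by rw [hK2]; gcongr; norm_num
  have hu : M*u^2 ≤ K2 * Z := u0.trans (by gcongr)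
  have hA0 : (n:ℝ)^(4*lam)/Gamma (2*lam)^2 ≤ M*v^2 := by
    rw [div_le_iff₀ (by positivity)]; exact A1
  have hA : M*v^2 ≤ (n:ℝ)^(4*lam)/Gamma (2*lam)^2 + K1 * Z := by
    have : M*v^2 ≤ ((n:ℝ)^(4*lam) + 242 * (n:ℝ)^(4*lam-1))/Gamma (2*lam)^2 := by
      rw [le_div_iff₀ (by positivity)]; exact A2
    refine this.trans ?_
    rw [add_div, hK1]
    have : 242 * (n:ℝ)^(4*lam-1) / Gamma (2*lam)^2 ≤ 243 / Gamma (2*lam)^2 * Z := by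
      rw [div_mul_eq_mul_div]; gcongr; norm_num
    linarith
  have hv : v^2 ≤ K1 * Z := by
    have e : (n:ℝ)^(4*lam) = n * (n:ℝ)^(4*lam-1) := by
      rw [rpow_sub_one hn0.ne']; field_simp
    have hp : 0 ≤ (n:ℝ)^(4*lam-1) := by positivity
    have h1 : n * v^2 * Gamma (2*lam)^2 ≤ n * (243 * Z) := by
      calc n * v^2 * Gamma (2*lam)^2 ≤ M * v^2 * Gamma (2*lam)^2 := by gcongr
        _ ≤ _ := A2
        _ ≤ n * (243 * (n:ℝ)^(4*lam-1)) := by rw [e]; nlinarith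
        _ ≤ _ := by gcongr
    have h2 : v^2 * Gamma (2*lam)^2 ≤ 243 * Z := by
      refine le_of_mul_le_mul_left ?_ hn0
      linarith
    rw [hK1, div_mul_eq_mul_div, le_div_iff₀ (by positivity)]; exact h2
  have hJ : J ≤ K4 * Z := by
    have c1 : (M/(2*lam) + (2*lam-1)/(4*lam)) * U ≤ 5*K2/(1-lam)/lam * Z := by
      have c2 : M/(2*lam) + (2*lam-1)/(4*lam) ≤ M / lam := by
        field_simp; linarith
      calc _ ≤ M/lam * U := by gcongr
        _ = (M * U)/lam := by ring
        _ ≤ ((M*u^2 + 4*lam^2*q^2)/(1-lam))/lam := by gcongr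
        _ ≤ ((K2*Z + 4*1*(K2*Z))/(1-lam))/lam := by
          gcongr
          nlinarith
        _ = _ := by ring
    have c3 : -((2*lam-1)/(4*lam) * v^2) ≤ K1/(4*lam) * Z := by
      have : -((2*lam-1)/(4*lam)) ≤ 1/(4*lam) := by
        rw [← neg_div]; gcongr; linarith
      calc _ = -((2*lam-1)/(4*lam)) * v^2 := by ring
        _ ≤ 1/(4*lam) * (K1 * Z) := by gcongr
        _ = _ := by ring
    have c4 : -(u*q) ≤ 2*K2*Z := by
      have : u^2 ≤ M*u^2 := le_mul_of_one_le_left (sq_nonneg _) hM1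
      nlinarith [sq_nonneg (u+q), sq_nonneg u, sq_nonneg q]
    have : 2*lam*J2 ≤ (5*K2/(1-lam)/lam + K1/(4*lam) + 2*K2) * Z := by
      rw [i2]; linarith
    refine hJ1.trans ?_
    rw [hK4, div_mul_eq_mul_div, le_div_iff₀ (by positivity)]
    linarith
  have eI : I + J - (n:ℝ)^(4*lam) / (4*lam*(2*lam*Gamma (2*lam))^2) =
      (M*v^2 - (n:ℝ)^(4*lam)/Gamma (2*lam)^2)/(16*lam^3) - q^2/(4*lam) - M*u^2/(16*lam^3) + J := by
    have : I = (M*v^2/(4*lam^2) - q^2 - M*u^2/(4*lam^2))/(4*lam) := by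
      rw [eq_div_iff (by positivity), ← i1]; ring
    rw [this]; field_simp; ring
  rw [eI]
  have t1 : 0 ≤ (M*v^2 - (n:ℝ)^(4*lam)/Gamma (2*lam)^2)/(16*lam^3) :=
    div_nonneg (by linarith) (by positivity)
  have t2 : (M*v^2 - (n:ℝ)^(4*lam)/Gamma (2*lam)^2)/(16*lam^3) ≤ K1/(16*lam^3) * Z := by
    rw [div_mul_eq_mul_div]; gcongr; linarith
  have t3 : 0 ≤ q^2/(4*lam) := by positivity
  have t4 : q^2/(4*lam) ≤ K2/(4*lam) * Z := by
    rw [div_mul_eq_mul_div]; gcongr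
  have t5 : 0 ≤ M*u^2/(16*lam^3) := by positivity
  have t6 : M*u^2/(16*lam^3) ≤ K2/(16*lam^3) * Z := by
    rw [div_mul_eq_mul_div]; gcongr
  have w1 : 0 ≤ K1/(16*lam^3) * Z := by positivity
  have w4 : 0 ≤ K4 * Z := by positivity
  rw [abs_le]
  constructor <;> linarith
end

section
/- Let λ ∈ (0, 1) and set δ(λ) := max{4λ−1, 2λ}. Then there exist a constant C > 0 and N ∈ ℕ such that for all n ≥ N, ∫₀¹ (1−x²)·[C_{n−1}^{(λ+1)}(x)]² dx ≤ (B(1−λ, 1/2)/Γ(λ+1)²) · n^{2λ}/2^{1+2λ} + C·n^{δ(λ)−1}, where B denotes the beta function. -/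
open Real MeasureTheory Finset

/-- The beta function `B(x,y) = Γ(x)Γ(y)/Γ(x+y)`. -/
noncomputable def betaFn (x y : ℝ) : ℝ := Real.Gamma x * Real.Gamma y / Real.Gamma (x + y)


lemma geg_succ2 (mu : ℝ) (k : ℕ) (x : ℝ) : ((k:ℝ)+2) * gegenbauer mu (k+2) x =
    2 * ((k : ℝ) + 1 + mu) * x * gegenbauer mu (k + 1) x
        - ((k : ℝ) + 2 * mu) * gegenbauer mu k x := by
  have : (k:ℝ)+2 ≠ 0 := by positivity
  rw [gegenbauer]; field_simp

lemma geg_contDiff (mu : ℝ) (k : ℕ) : ContDiff ℝ 2 (gegenbauer mu k) := by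
  induction k using Nat.strong_induction_on with
  | _ k ih =>
    match k, ih with
    | 0, _ => 
      have : gegenbauer mu 0 = fun _ => 1 := by funext x; rw [gegenbauer]
      rw [this]; fun_prop
    | 1, _ => 
      have : gegenbauer mu 1 = fun x => 2 * mu * x := by funext x; rw [gegenbauer]
      rw [this]; fun_prop
    | k+2, ih =>
      have h1 := ih (k+1) (by omega)
      have h0 := ih k (by omega)
      have : gegenbauer mu (k+2) = fun x => (2 * ((k : ℝ) + 1 + mu) * x * gegenbauer mu (k + 1) x
        - ((k : ℝ) + 2 * mu) * gegenbauer mu k x) / ((k : ℝ) + 2) := by funext x; rw [gegenbauer]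
      rw [this]; fun_prop

lemma geg_deriv_s3 (mu : ℝ) (x : ℝ) (hs : 1 - x^2 ≠ 0) (k : ℕ) :
    HasDerivAt (gegenbauer mu k)
      (((k + 2 * mu) * x * gegenbauer mu k x - (k+1) * gegenbauer mu (k+1) x) / (1 - x^2)) x ∧
    HasDerivAt (gegenbauer mu (k+1))
      (((k + 2 * mu) * gegenbauer mu k x - (k+1) * x * gegenbauer mu (k+1) x) / (1 - x^2)) x := by
  induction k with
  | zero =>
    have e0 : gegenbauer mu 0 = fun _ => 1 := by funext x; rw [gegenbauer]
    have e1 : gegenbauer mu 1 = fun x => 2 * mu * x := by funext x; rw [gegenbauer]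
    simp only [zero_add, e0, e1]
    constructor
    · refine (hasDerivAt_const x (1:ℝ)).congr_deriv ?_
      push_cast; ring
    · refine ((hasDerivAt_id x).const_mul (2*mu)).congr_deriv ?_
      push_cast; field_simp; ring
  | succ k ih =>
    obtain ⟨h0, h1⟩ := ih
    have hr := geg_succ2 mu k x
    have hk : (k:ℝ)+2 ≠ 0 := by positivity
    constructor
    · convert h1 using 2
      push_cast
      linear_combination -hr
    · have : gegenbauer mu (k+2) = fun x => (2 * ((k : ℝ) + 1 + mu) * (x * gegenbauer mu (k + 1) x)
        - ((k : ℝ) + 2 * mu) * gegenbauer mu k x) / ((k : ℝ) + 2) := by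
        funext x; rw [gegenbauer]; ring
      have hd := ((((hasDerivAt_id x).mul h1).const_mul (2 * ((k : ℝ) + 1 + mu))).sub
        (h0.const_mul ((k : ℝ) + 2 * mu))).div_const ((k:ℝ)+2)
      have hd2 := hd.congr_of_eventuallyEq (f₁ := gegenbauer mu (k+2)) (by rw [this]; rfl)
      refine hd2.congr_deriv ?_
      simp only [id, Nat.cast_add, Nat.cast_one]
      rw [show k+1+1 = k+2 from rfl]
      have hr' : gegenbauer mu (k+2) x = (2 * ((k : ℝ) + 1 + mu) * x * gegenbauer mu (k + 1) x
        - ((k : ℝ) + 2 * mu) * gegenbauer mu k x) / ((k:ℝ)+2) := by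
        rw [← hr]; field_simp
      rw [hr']
      field_simp
      ring

lemma geg_at_one_s3 (mu : ℝ) (k : ℕ) :
    ((k:ℝ)+1) * gegenbauer mu (k+1) 1 = (k + 2*mu) * gegenbauer mu k 1 := by
  induction k with
  | zero => simp [gegenbauer]
  | succ k ih =>
    have hr := geg_succ2 mu k 1
    push_cast
    rw [show k+1+1 = k+2 from rfl]
    linear_combination hr + ih

lemma geg_at_one_le (mu : ℝ) (hmu : 1 ≤ mu) (k : ℕ) :
    0 ≤ gegenbauer mu k 1 ∧ gegenbauer mu k 1 ≤ ((k:ℝ)+1) ^ (2*mu-1) := by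
  induction k with
  | zero => simp [gegenbauer]
  | succ k ih =>
    have h := geg_at_one_s3 mu k
    have hk : (0:ℝ) < (k:ℝ)+1 := by positivity
    have h' : gegenbauer mu (k+1) 1 = (1 + (2*mu-1) * (1/((k:ℝ)+1))) * gegenbauer mu k 1 := by
      field_simp; linear_combination h
    have hb := one_add_mul_self_le_rpow_one_add (s := 1/((k:ℝ)+1)) (by linarith [show 0 < 1/((k:ℝ)+1) by positivity]) (p := 2*mu-1) (by linarith)
    rw [h']
    constructor
    · apply mul_nonneg _ ih.1
      have : 0 ≤ (2*mu-1) * (1/((k:ℝ)+1)) := mul_nonneg (by linarith) (by positivity)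
      linarith
    · calc _ ≤ (1 + 1/((k:ℝ)+1)) ^ (2*mu-1) * ((k:ℝ)+1) ^ (2*mu-1) := by
            apply mul_le_mul hb ih.2 ih.1 (by positivity)
        _ = _ := by
            rw [← Real.mul_rpow (by positivity) (by positivity)]
            congr 1
            push_cast; field_simp

/-- Sonin-type bound near one. -/
lemma geg_le_at_one (mu : ℝ) (hmu : 1 ≤ mu) (k : ℕ) (x : ℝ) (hx : x ∈ Set.Icc (0:ℝ) 1) :
    (gegenbauer mu (k+1) x)^2 ≤ (gegenbauer mu (k+1) 1)^2 := by
  set y := gegenbauer mu (k+1) with hy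
  set K : ℝ := (k+1) * (k+1+2*mu) with hK
  have hKpos : 0 < K := by rw [hK]; positivity
  have hc := geg_contDiff mu (k+1)
  rw [← hy] at hc
  have hyd : Differentiable ℝ y := hc.differentiable (by norm_num)
  have hc1 : ContDiff ℝ 1 (deriv y) := by
    have := (contDiff_succ_iff_deriv (n := 1) (f := y)).1 (by rw [one_add_one_eq_two]; exact hc)
    exact this.2.2
  have hyd1 : Differentiable ℝ (deriv y) := hc1.differentiable (by norm_num)
  have hyc1 : Continuous (deriv y) := hc1.continuous
  have hyc : Continuous y := hc.continuous
  -- ODE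
  have ode : ∀ t ∈ Set.Ioo (0:ℝ) 1,
      (1 - t^2) * deriv (deriv y) t - (2*mu+1) * t * deriv y t + K * y t = 0 := by
    intro t ht
    have hs : 1 - t^2 ≠ 0 := by nlinarith [ht.1, ht.2]
    have h1 := geg_deriv_s3 mu t hs k
    have hev : (fun u => (1 - u^2) * deriv y u) =ᶠ[nhds t]
        fun u => (k + 2 * mu) * gegenbauer mu k u - (k+1) * (u * y u) := by
      filter_upwards [isOpen_Ioo.mem_nhds ht] with u hu
      have hs' : 1 - u^2 ≠ 0 := by nlinarith [hu.1, hu.2]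
      rw [(geg_deriv_s3 mu u hs' k).2.deriv]
      field_simp
      rw [hy]
    have hA : HasDerivAt (fun u => (1 - u^2) * deriv y u)
        ((-(2*t)) * deriv y t + (1-t^2) * deriv (deriv y) t) t := by
      have := ((hasDerivAt_pow 2 t).const_sub 1).mul (hyd1 t).hasDerivAt
      refine this.congr_deriv ?_
      push_cast; ring
    have hB := ((h1.1.const_mul ((k:ℝ)+2*mu)).sub (((hasDerivAt_id t).mul h1.2).const_mul ((k:ℝ)+1)))
    have hB' := hB.congr_of_eventuallyEq hev
    have hu := hA.unique hB'
    have hd : deriv y t = _ := h1.2.deriv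
    rw [hd] at hu ⊢
    simp only [id] at hu
    rw [hK]
    rw [hy]
    field_simp at hu ⊢
    linear_combination hu
  have hmono : MonotoneOn (fun t => (y t)^2 + (1 - t^2) * (deriv y t)^2 / K) (Set.Icc 0 1) := by
    apply monotoneOn_of_deriv_nonneg (convex_Icc 0 1)
    · fun_prop
    · fun_prop
    · intro t ht
      rw [interior_Icc] at ht
      have h := ((hyd t).hasDerivAt.pow 2).add
        ((((hasDerivAt_pow 2 t).const_sub 1).mul ((hyd1 t).hasDerivAt.pow 2)).div_const K)
      have : deriv (fun t => (y t)^2 + (1 - t^2) * (deriv y t)^2 / K) t = _ := h.deriv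
      rw [this]
      have ho := ode t ht
      have : 0 ≤ 4 * mu * t * (deriv y t)^2 / K := by
        have := ht.1
        positivity
      refine this.trans (le_of_eq ?_)
      simp only [Pi.pow_apply]
      field_simp
      push_cast
      linear_combination (-2 * deriv y t) * ho
  have := hmono hx (Set.right_mem_Icc.2 zero_le_one) hx.2
  simp only at this
  have h2 : 0 ≤ (1 - x^2) * (deriv y x)^2 / K := by
    have : 0 ≤ 1 - x^2 := by nlinarith [hx.1, hx.2]
    positivity
  norm_num at this
  linarith

/-- The energy bound. -/
lemma geg_energy (mu : ℝ) (hmu : 1 < mu) (k : ℕ) (x : ℝ) (hx0 : 0 ≤ x) (hx1 : x < 1) :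
    (1-x^2)^(mu-1) * (((k+1+mu)^2 * (1-x^2) - mu*(mu-1)) * (gegenbauer mu (k+1) x)^2) ≤
    (k+2*mu)^2 * (gegenbauer mu k 0)^2 +
      ((k+1+mu)^2 - mu*(mu-1)) * (gegenbauer mu (k+1) 0)^2 := by
  set p := gegenbauer mu (k+1) with hp
  set q := gegenbauer mu k with hq
  set m : ℝ := k+1+mu with hm
  set c : ℝ := k+2*mu with hcc
  have hanti : AntitoneOn (fun t => (1-t^2)^(mu-1) *
      (c^2 * (q t)^2 - 2*c*m*(t*(p t * q t)) + (m^2 - mu*(mu-1)) * (p t)^2)) (Set.Ico 0 1) := by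
    have key : ∀ t ∈ Set.Ico (0:ℝ) 1, HasDerivAt (fun t => (1-t^2)^(mu-1) *
      (c^2 * (q t)^2 - 2*c*m*(t*(p t * q t)) + (m^2 - mu*(mu-1)) * (p t)^2))
      (-(2*mu*(mu-1)*t*((1-t^2)^(mu-1-1) * (p t)^2))) t := by
      intro t ht
      have hs : 0 < 1 - t^2 := by nlinarith [ht.1, ht.2]
      obtain ⟨hdq, hdp⟩ := geg_deriv_s3 mu t hs.ne' k
      rw [← hp, ← hq] at hdq
      rw [← hp, ← hq] at hdp
      have h1 := ((hasDerivAt_pow 2 t).const_sub 1).rpow_const (p := mu-1) (Or.inl hs.ne')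
      have h2 := (((hdq.pow 2).const_mul (c^2)).sub
        (((hasDerivAt_id t).mul (hdp.mul hdq)).const_mul (2*c*m))).add
        ((hdp.pow 2).const_mul (m^2-mu*(mu-1)))
      have h3 := h1.mul h2
      refine h3.congr_deriv ?_
      have e : (1-t^2)^(mu-1) = (1-t^2)^(mu-1-1) * (1-t^2) := by
        rw [Real.rpow_sub_one hs.ne' (mu-1)]; field_simp
      simp only [Pi.pow_apply, Pi.mul_apply, Pi.add_apply, Pi.sub_apply, id]
      rw [e]
      have := hs.ne'
      field_simp
      rw [hm, hcc]
      push_cast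
      ring
    apply antitoneOn_of_deriv_nonpos (convex_Ico 0 1)
    · intro t ht
      exact (key t ht).continuousAt.continuousWithinAt
    · intro t ht
      exact (key t (interior_subset ht)).differentiableAt.differentiableWithinAt
    · intro t ht
      have ht := interior_subset ht
      rw [(key t ht).deriv]
      have hs : 0 < 1 - t^2 := by nlinarith [ht.1, ht.2]
      have h1 := ht.1
      have h2 : 0 < mu - 1 := by linarith
      have : 0 ≤ 2*mu*(mu-1)*t*((1-t^2)^(mu-1-1) * (p t)^2) := by positivity
      linarith
  have := hanti (Set.left_mem_Ico.2 one_pos) ⟨hx0, hx1⟩ hx0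
  simp only at this
  norm_num at this
  refine le_trans ?_ this
  have hs : 0 < 1 - x^2 := by nlinarith
  apply mul_le_mul_of_nonneg_left _ (by positivity)
  nlinarith [sq_nonneg (c * q x - m * x * p x)]

lemma geg_zero_odd (mu : ℝ) (j : ℕ) : gegenbauer mu (2*j+1) 0 = 0 := by
  induction j with
  | zero => simp [gegenbauer]
  | succ j ih =>
    rw [show 2*(j+1)+1 = (2*j+1)+2 by ring, gegenbauer, ih]; simp

lemma geg_zero_even (lam : ℝ) (h0 : 0 < lam) (j : ℕ) :
    |gegenbauer (lam+1) (2*j) 0| = Real.Gamma (j+1+lam) / (Real.Gamma (lam+1) * Real.Gamma (j+1)) := by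
  induction j with
  | zero => 
    have := (Real.Gamma_pos_of_pos (show 0 < lam+1 by linarith)).ne'
    simp [gegenbauer]
    rw [add_comm 1 lam]; field_simp
  | succ j ih =>
    have hg := (Real.Gamma_pos_of_pos (show 0 < lam+1 by linarith)).ne'
    have hg1 := (Real.Gamma_pos_of_pos (show 0 < (j:ℝ)+1 by positivity)).ne'
    rw [show 2*(j+1) = (2*j)+2 by ring, gegenbauer]
    have e : (2 * (((2*j:ℕ) : ℝ) + 1 + (lam+1)) * 0 * gegenbauer (lam+1) (2*j + 1) 0
        - (((2*j:ℕ) : ℝ) + 2 * (lam+1)) * gegenbauer (lam+1) (2*j) 0) / (((2*j:ℕ) : ℝ) + 2)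
        = -((j+1+lam)/(j+1)) * gegenbauer (lam+1) (2*j) 0 := by
      push_cast
      field_simp
      ring
    rw [e, abs_mul, ih, abs_neg, abs_of_pos (by positivity)]
    push_cast
    rw [show (j:ℝ)+1+1+lam = (j+1+lam)+1 by ring, Real.Gamma_add_one (s := (j:ℝ)+1+lam) (by positivity),
      Real.Gamma_add_one (s := (j:ℝ)+1) (by positivity)]
    field_simp

lemma geg_zero_even_le (lam : ℝ) (h0 : 0 < lam) (h1 : lam < 1) (j : ℕ) :
    |gegenbauer (lam+1) (2*j) 0| ≤ ((j:ℝ)+1)^lam / Real.Gamma (lam+1) := by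
  rw [geg_zero_even lam h0]
  have hg := (Real.Gamma_pos_of_pos (show 0 < lam+1 by linarith))
  have hg1 := (Real.Gamma_pos_of_pos (show 0 < (j:ℝ)+1 by positivity))
  have h := Real.Gamma_mul_add_mul_le_rpow_Gamma_mul_rpow_Gamma (s := (j:ℝ)+1) (t := (j:ℝ)+2)
    (a := 1-lam) (b := lam) (by positivity) (by positivity) (by linarith) h0 (by ring)
  rw [show (1-lam)*((j:ℝ)+1) + lam*((j:ℝ)+2) = j+1+lam by ring,
    show (j:ℝ)+2 = (j+1)+1 by ring, Real.Gamma_add_one (s := (j:ℝ)+1) (by positivity),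
    Real.mul_rpow (by positivity) hg1.le] at h
  have e : Real.Gamma ((j:ℝ)+1) ^ (1-lam) * (((j:ℝ)+1)^lam * Real.Gamma ((j:ℝ)+1) ^ lam)
      = ((j:ℝ)+1)^lam * Real.Gamma ((j:ℝ)+1) := by
    rw [mul_left_comm, ← Real.rpow_add hg1]; simp
  rw [e] at h
  rw [div_le_div_iff₀ (by positivity) hg]
  nlinarith

lemma beta_int (lam : ℝ) (h0 : 0 < lam) (h1 : lam < 1) :
    (∫ x in (0:ℝ)..1, (1-x^2)^(-lam)) = betaFn (1-lam) (1/2) / 2 := by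
  have hb : betaFn (1-lam) (1/2) = ∫ x in (0:ℝ)..1, x^(-(1/2):ℝ) * (1-x)^(-lam) := by
    have e1 : betaFn (1-lam) (1/2) = ProbabilityTheory.beta (1/2) (1-lam) := by
      unfold betaFn ProbabilityTheory.beta
      rw [mul_comm, add_comm]
    rw [e1, ProbabilityTheory.beta_eq_betaIntegralReal _ _ (by norm_num) (by linarith),
      Complex.betaIntegral]
    have e2 : (∫ x in (0:ℝ)..1, (x:ℂ) ^ (((1/2:ℝ):ℂ) - 1) * (1 - (x:ℂ)) ^ (((1-lam:ℝ):ℂ) - 1))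
        = ∫ x in (0:ℝ)..1, ((x^(-(1/2):ℝ) * (1-x)^(-lam) : ℝ) : ℂ) := by
      apply intervalIntegral.integral_congr
      intro x hx
      rw [Set.uIcc_of_le zero_le_one] at hx
      simp only
      rw [Complex.ofReal_mul, Complex.ofReal_cpow hx.1, Complex.ofReal_cpow (by linarith [hx.2])]
      push_cast
      congr 2 <;> ring
    rw [e2, intervalIntegral.integral_ofReal, Complex.ofReal_re]
  rw [hb]
  have hs := integral_comp_rpow_Ioi_of_pos (g := Set.indicator (Set.Iic 1)
    (fun x : ℝ => x^(-(1/2):ℝ) * (1-x)^(-lam))) (p := 2) (by norm_num)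
  rw [setIntegral_indicator measurableSet_Iic, Set.Ioi_inter_Iic] at hs
  rw [intervalIntegral.integral_of_le zero_le_one, intervalIntegral.integral_of_le zero_le_one, ← hs]
  have e3 : Set.EqOn (fun x : ℝ => (2 * x^((2:ℝ)-1)) • Set.indicator (Set.Iic 1)
    (fun x : ℝ => x^(-(1/2):ℝ) * (1-x)^(-lam)) (x^(2:ℝ)))
    (fun x => Set.indicator (Set.Iic 1) (fun x => 2 * (1-x^2)^(-lam)) x) (Set.Ioi 0) := by
    intro x hx
    have hx : 0 < x := hx
    simp only
    by_cases hx1 : x ≤ 1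
    · have hx2 : x^(2:ℝ) ≤ 1 := Real.rpow_le_one hx.le hx1 (by norm_num)
      rw [Set.indicator_of_mem (by exact hx2), Set.indicator_of_mem (by exact hx1), ← Real.rpow_mul hx.le]
      norm_num
      rw [Real.rpow_neg_one]
      field_simp
    · have hx2 : ¬ x^(2:ℝ) ≤ 1 := by
        rw [not_le] at *
        exact Real.one_lt_rpow hx1 (by norm_num)
      rw [Set.indicator_of_notMem (by exact hx2), Set.indicator_of_notMem (by exact hx1)]
      simp
  rw [setIntegral_congr_fun measurableSet_Ioi e3, setIntegral_indicator measurableSet_Iic,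
    Set.Ioi_inter_Iic, integral_const_mul]
  ring

lemma beta_integrable (lam : ℝ) (h0 : 0 < lam) (h1 : lam < 1) :
    IntervalIntegrable (fun x : ℝ => (1-x^2)^(-lam)) volume 0 1 := by
  have hI : IntervalIntegrable (fun x : ℝ => (1-x)^(-lam)) volume 0 1 := by
    have := (intervalIntegral.intervalIntegrable_rpow' (a := 0) (b := 1) (r := -lam) (by linarith)).comp_sub_left 1
    simpa using this.symm
  refine hI.mono_fun ?_ ?_
  · exact (by fun_prop : Measurable (fun x : ℝ => (1-x^2)^(-lam))).aestronglyMeasurable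
  · rw [Set.uIoc_of_le zero_le_one]
    filter_upwards [ae_restrict_mem measurableSet_Ioc, ae_restrict_of_ae (Measure.ae_ne volume (1:ℝ))] with x hx hx1
    have hx2 : x < 1 := lt_of_le_of_ne hx.2 hx1
    have a1 : 0 < 1 - x := by linarith
    have a2 : 1 - x ≤ 1 - x^2 := by nlinarith [hx.1]
    rw [Real.norm_of_nonneg (by have := a1.trans_le a2; positivity), Real.norm_of_nonneg (by positivity)]
    exact Real.rpow_le_rpow_of_nonpos a1 a2 (by linarith)

lemma tail_int (lam : ℝ) (h0 : 0 < lam) (e : ℝ) (he : 0 < e) (he1 : e ≤ 1) :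
    IntervalIntegrable (fun x : ℝ => (1-x)^(-1-lam)) volume 0 (1-e) ∧
    (∫ x in (0:ℝ)..(1-e), (1-x)^(-1-lam)) ≤ e^(-lam)/lam := by
  have hn : (0:ℝ) ∉ Set.uIcc e 1 := by
    rw [Set.uIcc_of_le he1]; intro h; linarith [h.1]
  constructor
  · have := (intervalIntegral.intervalIntegrable_rpow (a := 1) (b := e) (μ := volume) (r := -1-lam) (Or.inr (by rwa [Set.uIcc_comm]))).comp_sub_left 1
    simpa using this
  · rw [intervalIntegral.integral_comp_sub_left (fun x => x^(-1-lam)) 1]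
    rw [sub_sub_cancel, sub_zero, integral_rpow (Or.inr ⟨by linarith, hn⟩)]
    rw [show -1 - lam + 1 = -lam by ring, Real.one_rpow, div_neg, ← neg_div, neg_sub]
    gcongr
    linarith

lemma geg_zero_even_sq (lam : ℝ) (h0 : 0 < lam) (h1 : lam < 1) (j : ℕ) :
    (gegenbauer (lam+1) (2*j) 0)^2 ≤ ((j:ℝ)+1)^(2*lam) / Real.Gamma (lam+1)^2 := by
  have hb := geg_zero_even_le lam h0 h1 j
  rw [← sq_abs]
  calc _ ≤ (((j:ℝ)+1)^lam / Real.Gamma (lam+1))^2 := by gcongr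
    _ = _ := by
      rw [div_pow, ← Real.rpow_natCast (((j:ℝ)+1)^lam), ← Real.rpow_mul (by positivity)]
      push_cast
      rw [mul_comm lam 2]

/-- Bound for the energy at zero. -/
lemma energy_zero (lam : ℝ) (h0 : 0 < lam) (h1 : lam < 1) (k : ℕ) :
    ((k+2*(lam+1))^2 * (gegenbauer (lam+1) k 0)^2 +
      ((k+1+(lam+1))^2 - (lam+1)*(lam+1-1)) * (gegenbauer (lam+1) (k+1) 0)^2) ≤
    ((k:ℝ)+2+lam)^2 * ((((k:ℝ)+2)/2)^(2*lam) / Real.Gamma (lam+1)^2 * (1 + 1/((k:ℝ)+2))^2) := by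
  have hg := (Real.Gamma_pos_of_pos (show 0 < lam+1 by linarith))
  rcases Nat.even_or_odd' k with ⟨j, rfl | rfl⟩
  · rw [geg_zero_odd]
    have hb := geg_zero_even_sq lam h0 h1 j
    have e : (j:ℝ)+1 = (((2*j:ℕ):ℝ)+2)/2 := by push_cast; ring
    rw [e] at hb
    have ht : (0:ℝ) ≤ ((2*j:ℕ):ℝ) := by positivity
    generalize gegenbauer (lam+1) (2*j) 0 = g at *
    generalize ((2*j:ℕ):ℝ) = t at *
    have hc : t + 2*(lam+1) ≤ (t+2+lam) * (1+1/(t+2)) := by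
      have : (t+2+lam) * (1+1/(t+2)) = t+2+lam + 1 + lam/(t+2) := by field_simp; ring
      rw [this]
      have : 0 ≤ lam/(t+2) := by positivity
      linarith
    calc _ = (t + 2*(lam+1))^2 * g^2 := by ring
      _ ≤ ((t+2+lam) * (1+1/(t+2)))^2 * (((t + 2) / 2) ^ (2 * lam) / Gamma (lam + 1) ^ 2) := by
        gcongr
      _ = _ := by ring
  · rw [geg_zero_odd]
    have hb := geg_zero_even_sq lam h0 h1 (j+1)
    rw [show 2*j+1+1 = 2*(j+1) by ring]
    have ht : (0:ℝ) ≤ ((2*j+1:ℕ):ℝ) := by positivity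
    have e : ((j+1:ℕ):ℝ)+1 = (((2*j+1:ℕ):ℝ)+2)/2 * (1 + 1/(((2*j+1:ℕ):ℝ)+2)) := by
      field_simp; push_cast; ring
    rw [e] at hb
    generalize gegenbauer (lam+1) (2*(j+1)) 0 = g at *
    generalize ((2*j+1:ℕ):ℝ) = t at *
    rw [Real.mul_rpow (by positivity) (by positivity)] at hb
    have hp : (1+1/(t+2))^(2*lam) ≤ (1+1/(t+2))^2 := by
      rw [← Real.rpow_natCast]
      apply Real.rpow_le_rpow_of_exponent_le
      · have : 0 ≤ 1/(t+2) := by positivity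
        linarith
      · push_cast; linarith
    calc _ = ((t+1+(lam+1))^2 - (lam+1)*lam) * g^2 := by ring
      _ ≤ (t+2+lam)^2 * g^2 := by
        apply mul_le_mul_of_nonneg_right _ (sq_nonneg g)
        nlinarith
      _ ≤ (t+2+lam)^2 * (((t + 2) / 2) ^ (2 * lam) * (1+1/(t+2))^2 / Gamma (lam + 1) ^ 2) := by
        gcongr
        exact hb.trans (by gcongr)
      _ = _ := by ring

lemma geg_pointwise (lam : ℝ) (h0 : 0 < lam) (h1 : lam < 1) (k : ℕ) (x : ℝ) (hx0 : 0 ≤ x)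
    (hx1 : x ≤ 1 - 4/((k:ℝ)+2)^2) :
    (1-x^2) * (gegenbauer (lam+1) (k+1) x)^2 ≤
      ((((k:ℝ)+2)/2)^(2*lam) / Real.Gamma (lam+1)^2 * (1 + 1/((k:ℝ)+2))^2) *
      ((1-x^2)^(-lam) + 4/((k:ℝ)+2)^2 * (1-x)^(-1-lam)) := by
  have hn : (0:ℝ) < (k:ℝ)+2 := by positivity
  have hq : 0 < 4/((k:ℝ)+2)^2 := by positivity
  have hE := (geg_energy (lam+1) (by linarith) k x hx0 (by linarith)).trans (energy_zero lam h0 h1 k)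
  set M := ((((k:ℝ)+2)/2)^(2*lam) / Real.Gamma (lam+1)^2 * (1 + 1/((k:ℝ)+2))^2) with hM
  have hM0 : 0 ≤ M := by positivity
  set y := (gegenbauer (lam+1) (k+1) x)^2 with hy
  have hy0 : 0 ≤ y := sq_nonneg _
  set n := (k:ℝ)+2 with hnn
  set s := 1 - x^2 with hs
  have hsx : 1 - x ≤ s := by rw [hs]; nlinarith
  have hns : 4/n^2 ≤ s := by linarith
  have hs0 : 0 < s := by linarith
  have hns' : 4 ≤ n^2 * s := by
    rw [div_le_iff₀ (by positivity)] at hns; linarith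
  rw [show (k:ℝ)+1+(lam+1) = n+lam by rw [hnn]; ring, show lam+1-1 = lam by ring] at hE
  have hpow : 0 < s^lam := by positivity
  -- main inequality
  have hmain : s * y ≤ M * s^(-lam) * (1 + 4/(n^2*s)) := by
    have hk : (n+lam)^2 * s ≤ ((n+lam)^2*s - (lam+1)*lam) * (1 + 4/(n^2*s)) := by
      have e : ((n+lam)^2*s - (lam+1)*lam) * (1 + 4/(n^2*s)) - (n+lam)^2*s =
        4 * ((n+lam)^2/n^2) - (lam+1)*lam - (lam+1)*lam*(4/(n^2*s)) := by
        field_simp; ring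
      have a1 : 1 ≤ (n+lam)^2/n^2 := by
        rw [le_div_iff₀ (by positivity)]; nlinarith
      have a2 : 4/(n^2*s) ≤ 1 := by
        rw [div_le_one (by positivity)]; exact hns'
      have a3 : (lam+1)*lam ≤ 2 := by nlinarith
      have a4 : 0 ≤ (lam+1)*lam := by positivity
      have a5 := mul_le_mul_of_nonneg_left a2 a4
      linarith
    have h2 : s^lam * (n+lam)^2 * (s * y) ≤ (n+lam)^2 * M * (1 + 4/(n^2*s)) := by
      calc s^lam * (n+lam)^2 * (s * y) = s^lam * y * ((n+lam)^2 * s) := by ring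
        _ ≤ s^lam * y * (((n+lam)^2*s - (lam+1)*lam) * (1 + 4/(n^2*s))) := by gcongr
        _ = (s^lam * (((n+lam)^2*s - (lam+1)*lam) * y)) * (1 + 4/(n^2*s)) := by ring
        _ ≤ _ := by gcongr
    rw [Real.rpow_neg hs0.le]
    have hnl : 0 < (n+lam)^2 := by positivity
    have h3 : s * y ≤ ((n+lam)^2 * M * (1 + 4/(n^2*s))) / (s^lam * (n+lam)^2) := by
      rw [le_div_iff₀ (by positivity)]; linarith
    refine h3.trans (le_of_eq ?_)
    field_simp
  refine hmain.trans ?_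
  rw [mul_assoc]
  apply mul_le_mul_of_nonneg_left _ hM0
  have e : s^(-lam) * (1 + 4/(n^2*s)) = s^(-lam) + 4/n^2 * s^(-1-lam) := by
    rw [show -1-lam = -lam-1 by ring, Real.rpow_sub_one hs0.ne']
    field_simp
  rw [e]
  have : s^(-1-lam) ≤ (1-x)^(-1-lam) :=
    Real.rpow_le_rpow_of_nonpos (by linarith) hsx (by linarith)
  gcongr

lemma geg_near_one (lam : ℝ) (h0 : 0 < lam) (k : ℕ) (x : ℝ)
    (hx0 : 1 - 4/((k:ℝ)+2)^2 ≤ x) (hx1 : x ≤ 1) (hx : 0 ≤ x) :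
    (1-x^2) * (gegenbauer (lam+1) (k+1) x)^2 ≤ 8/((k:ℝ)+2)^2 * ((k:ℝ)+2)^(4*lam+2) := by
  have h := geg_le_at_one (lam+1) (by linarith) k x ⟨hx, hx1⟩
  have h' := geg_at_one_le (lam+1) (by linarith) (k+1)
  have h2 : (gegenbauer (lam+1) (k+1) 1)^2 ≤ ((k:ℝ)+2)^(4*lam+2) := by
    calc _ ≤ ((((k+1:ℕ):ℝ)+1)^(2*(lam+1)-1))^2 := pow_le_pow_left₀ h'.1 h'.2 2
      _ = _ := by
        rw [← Real.rpow_natCast, ← Real.rpow_mul (by positivity)]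
        push_cast
        congr 1 <;> ring
  apply mul_le_mul _ (h.trans h2) (sq_nonneg _) (by positivity)
  have : 8/((k:ℝ)+2)^2 = 2*(4/((k:ℝ)+2)^2) := by ring
  rw [this]
  nlinarith

lemma geg_integral (lam : ℝ) (h0 : 0 < lam) (h1 : lam < 1) (k : ℕ) :
    (∫ x in (0:ℝ)..1, (1 - x ^ 2) * (gegenbauer (lam + 1) (k+1) x) ^ 2) ≤
      ((((k:ℝ)+2)/2)^(2*lam) / Real.Gamma (lam+1)^2 * (1 + 1/((k:ℝ)+2))^2) *
      (betaFn (1-lam) (1/2) / 2 + 4/((k:ℝ)+2)^2 * ((4/((k:ℝ)+2)^2)^(-lam)/lam))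
      + 4/((k:ℝ)+2)^2 * (8/((k:ℝ)+2)^2 * ((k:ℝ)+2)^(4*lam+2)) := by
  set M := ((((k:ℝ)+2)/2)^(2*lam) / Real.Gamma (lam+1)^2 * (1 + 1/((k:ℝ)+2))^2) with hM
  have hM0 : 0 ≤ M := by positivity
  have hc : Continuous (fun x : ℝ => (1 - x ^ 2) * (gegenbauer (lam + 1) (k+1) x) ^ 2) := by
    have := (geg_contDiff (lam+1) (k+1)).continuous
    fun_prop
  have he0 : 0 < 4/((k:ℝ)+2)^2 := by positivity
  have he1 : 4/((k:ℝ)+2)^2 ≤ 1 := by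
    rw [div_le_one (by positivity)]
    nlinarith [show (0:ℝ) ≤ k by positivity]
  have hpt := geg_pointwise lam h0 h1 k
  have hpt1 := geg_near_one lam h0 k
  set e := 4/((k:ℝ)+2)^2 with he
  have hB := beta_integrable lam h0 h1
  obtain ⟨hT, hT'⟩ := tail_int lam h0 e he0 he1
  rw [← intervalIntegral.integral_add_adjacent_intervals (hc.intervalIntegrable 0 (1-e))
    (hc.intervalIntegrable (1-e) 1)]
  have hB1 : IntervalIntegrable (fun x : ℝ => (1-x^2)^(-lam)) volume 0 (1-e) :=
    hB.mono_set (by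
      rw [Set.uIcc_of_le (by linarith), Set.uIcc_of_le zero_le_one]
      exact Set.Icc_subset_Icc_right (by linarith))
  have hB2 : IntervalIntegrable (fun x : ℝ => (1-x^2)^(-lam)) volume (1-e) 1 :=
    hB.mono_set (by
      rw [Set.uIcc_of_le (by linarith), Set.uIcc_of_le zero_le_one]
      exact Set.Icc_subset_Icc_left (by linarith))
  apply add_le_add
  · calc _ ≤ ∫ x in (0:ℝ)..(1-e), M * ((1-x^2)^(-lam) + e * (1-x)^(-1-lam)) := by
          apply intervalIntegral.integral_mono_on (by linarith) (hc.intervalIntegrable _ _)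
            ((hB1.add (hT.const_mul e)).const_mul M)
          intro x hx
          exact hpt x hx.1 hx.2
      _ = M * ((∫ x in (0:ℝ)..(1-e), (1-x^2)^(-lam)) + e * ∫ x in (0:ℝ)..(1-e), (1-x)^(-1-lam)) := by
          rw [intervalIntegral.integral_const_mul, intervalIntegral.integral_add hB1 (hT.const_mul e),
            intervalIntegral.integral_const_mul]
      _ ≤ _ := by
          have : (∫ x in (0:ℝ)..(1-e), (1-x^2)^(-lam)) ≤ betaFn (1-lam) (1/2) / 2 := by
            rw [← beta_int lam h0 h1, ← intervalIntegral.integral_add_adjacent_intervals hB1 hB2]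
            have : 0 ≤ ∫ x in (1-e)..1, (1-x^2)^(-lam) := by
              apply intervalIntegral.integral_nonneg (by linarith)
              intro x hx
              have : 0 ≤ 1 - x^2 := by nlinarith [hx.1, hx.2]
              positivity
            linarith
          gcongr
  · calc _ ≤ ∫ x in (1-e)..1, 8/((k:ℝ)+2)^2 * ((k:ℝ)+2)^(4*lam+2) := by
          apply intervalIntegral.integral_mono_on (by linarith) (hc.intervalIntegrable _ _)
            (by simp)
          intro x hx
          exact hpt1 x hx.1 hx.2 (by linarith [hx.1])
      _ = _ := by
          rw [intervalIntegral.integral_const]; simp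

theorem gegenbauer_weighted_L2_norm_bound_small_lambda (lam : ℝ)
    (hlam : lam ∈ Set.Ioo (0 : ℝ) 1) :
    ∃ (C : ℝ) (N : ℕ), 0 < C ∧ ∀ n : ℕ, N ≤ n →
      (∫ x in (0:ℝ)..1, (1 - x ^ 2) * (gegenbauer (lam + 1) (n - 1) x) ^ 2)
      ≤ (betaFn (1 - lam) (1/2) / Real.Gamma (lam + 1) ^ 2)
          * (n : ℝ) ^ (2 * lam) / (2 : ℝ) ^ (1 + 2 * lam)
        + C * (n : ℝ) ^ (max (4 * lam - 1) (2 * lam) - 1) := by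
  obtain ⟨h0, h1⟩ := hlam
  have hg := (Real.Gamma_pos_of_pos (show 0 < lam+1 by linarith))
  have hB : 0 < betaFn (1-lam) (1/2) :=
    ProbabilityTheory.beta_pos (by linarith) (by norm_num)
  set B := betaFn (1-lam) (1/2) with hBdef
  set G := Real.Gamma (lam+1)^2 with hG
  have hG0 : 0 < G := by positivity
  refine ⟨3*B/(2*G) + 16/(G*lam) + 32, 2, by positivity, ?_⟩
  intro n hn
  obtain ⟨k, rfl⟩ := Nat.exists_eq_add_of_le' hn
  have hI := geg_integral lam h0 h1 k
  rw [← hBdef, ← hG] at hI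
  rw [show k+2-1 = k+1 by omega]
  refine hI.trans ?_
  push_cast
  have hk : (0:ℝ) ≤ k := by positivity
  set t := (k:ℝ)+2 with ht
  have ht2 : 2 ≤ t := by linarith
  have ht0 : 0 < t := by linarith
  set P := t ^ (max (4 * lam - 1) (2 * lam) - 1) with hP
  have hP1 : t^(4*lam-2) ≤ P := by
    apply Real.rpow_le_rpow_of_exponent_le (by linarith)
    linarith [le_max_left (4*lam-1) (2*lam)]
  have hP2 : t^(2*lam-1) ≤ P := by
    apply Real.rpow_le_rpow_of_exponent_le (by linarith)
    linarith [le_max_right (4*lam-1) (2*lam)]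
  have e1 : (t/2)^(2*lam) = t^(2*lam) / 2^(2*lam) := Real.div_rpow ht0.le (by norm_num) _
  have e2 : (2:ℝ)^(1+2*lam) = 2 * 2^(2*lam) := by
    rw [Real.rpow_add (by norm_num), Real.rpow_one]
  have h2l : (1:ℝ) ≤ 2^(2*lam) := Real.one_le_rpow (by norm_num) (by linarith)
  have hle : (t/2)^(2*lam) ≤ t^(2*lam) := by
    rw [e1]; exact div_le_self (by positivity) h2l
  have hsq : (1+1/t)^2 ≤ 1 + 3/t := by
    have : 1/t ≤ 1 := by rw [div_le_one ht0]; linarith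
    have h' : 0 < 1/t := by positivity
    have : (3:ℝ)/t = 3*(1/t) := by ring
    rw [this]; nlinarith
  have hsq4 : (1+1/t)^2 ≤ 4 := by
    have : 1/t ≤ 1 := by rw [div_le_one ht0]; linarith
    have h' : 0 < 1/t := by positivity
    nlinarith
  have e3 : t^(2*lam-1) = t^(2*lam)/t := Real.rpow_sub_one ht0.ne' _
  have e4 : t^(4*lam-2) = t^(2*lam) * t^(2*lam) / t^2 := by
    rw [show 4*lam-2 = 2*lam+2*lam-(2:ℕ) by push_cast; ring, Real.rpow_sub_natCast ht0.ne',
      Real.rpow_add ht0]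
  have e5 : t^(4*lam+2) = t^(4*lam-2) * t^4 := by
    rw [← Real.rpow_natCast, ← Real.rpow_add ht0]; congr 1; push_cast; ring
  have h6 : (4/t^2)^(-lam) ≤ t^(2*lam) := by
    calc (4/t^2)^(-lam) ≤ (1/t^2)^(-lam) := by
          apply Real.rpow_le_rpow_of_nonpos (by positivity) (by gcongr; norm_num) (by linarith)
      _ = t^(2*lam) := by
          rw [one_div, Real.inv_rpow (by positivity), Real.rpow_neg (by positivity), inv_inv,
            ← Real.rpow_natCast, ← Real.rpow_mul ht0.le]
          norm_num
  have t1 : (t/2)^(2*lam)/G*(1+1/t)^2*(B/2) ≤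
      B/G * t^(2*lam) / 2^(1+2*lam) + 3*B/(2*G) * P := by
    calc (t/2)^(2*lam)/G*(1+1/t)^2*(B/2) ≤ (t/2)^(2*lam)/G*(1+3/t)*(B/2) := by gcongr
      _ = (t/2)^(2*lam)/G*(B/2) + 3*B/(2*G) * ((t/2)^(2*lam)/t) := by field_simp
      _ ≤ (t/2)^(2*lam)/G*(B/2) + 3*B/(2*G) * (t^(2*lam)/t) := by gcongr
      _ ≤ (t/2)^(2*lam)/G*(B/2) + 3*B/(2*G) * P := by rw [← e3]; gcongr
      _ = _ := by rw [e1, e2]; field_simp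
  have t2 : (t/2)^(2*lam)/G*(1+1/t)^2*(4/t^2*((4/t^2)^(-lam)/lam)) ≤ 16/(G*lam) * P := by
    calc _ ≤ t^(2*lam)/G*4*(4/t^2*(t^(2*lam)/lam)) := by gcongr
      _ = 16/(G*lam) * t^(4*lam-2) := by rw [e4]; field_simp; norm_num
      _ ≤ _ := by gcongr
  have t3 : 4/t^2*(8/t^2*t^(4*lam+2)) ≤ 32 * P := by
    calc _ = 32 * t^(4*lam-2) := by rw [e5]; field_simp; norm_num
      _ ≤ _ := by gcongr
  calc _ = (t/2)^(2*lam)/G*(1+1/t)^2*(B/2) + (t/2)^(2*lam)/G*(1+1/t)^2*(4/t^2*((4/t^2)^(-lam)/lam))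
        + 4/t^2*(8/t^2*t^(4*lam+2)) := by ring
    _ ≤ _ := by linarith
end
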